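/- arXiv:1704.03827 — 3 statements merged into one kernel-verified Lean document; each statement's English description precedes it below -/
import Mathlib

section
/- Let (X, ‖·‖_X) and (Y, ‖·‖_Y) be real Banach spaces, F : X → Y a C¹ map with Fréchet derivative DF, and A : Y → X, A† : X → Y bounded linear operators. Let X̄ ∈ X, r > 0, and nonnegative constants Y₀, Z₀, Z₁, Z₂ satisfy: ‖A(F(X̄))‖_X ≤ Y₀; the operator norm of I − A∘A† on X is ≤ Z₀; the operator norm of A∘(DF(X̄) − A†) is ≤ Z₁; for every X in the closed ball B(X̄, r), the operator norm of A∘(DF(X) − DF(X̄)) is ≤ r·Z₂; and Z₂·r² − (1 − (Z₀ + Z₁))·r + Y₀ < 0. Then the map T : X → X defined by T(X) = X − A(F(X)) has a unique fixed point in the closed ball B(X̄, r). -/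
/-- A map that is Lipschitz on a closed ball with constant `K < 1`, and moves the center by at most
`(1 - K) * r`, has a unique fixed point in that ball. -/
theorem existsUnique_fixedPoint_closedBall {E : Type*} [MetricSpace E] [CompleteSpace E]
    {T : E → E} {c : E} {r : ℝ} {K : NNReal} (hr : 0 ≤ r) (hK : K < 1)
    (hT : LipschitzOnWith K T (Metric.closedBall c r)) (hc : dist (T c) c ≤ (1 - K) * r) :
    ∃! x, x ∈ Metric.closedBall c r ∧ T x = x := by
  have hmem : c ∈ Metric.closedBall c r := Metric.mem_closedBall_self hr
  have hmaps : Set.MapsTo T (Metric.closedBall c r) (Metric.closedBall c r) := fun x hx => by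
    have h := hT.dist_le_mul x hx c hmem
    have hx' : (K : ℝ) * dist x c ≤ K * r :=
      mul_le_mul_of_nonneg_left (Metric.mem_closedBall.1 hx) K.2
    rw [Metric.mem_closedBall]
    linarith [dist_triangle (T x) (T c) c]
  have hcontr : ContractingWith K (hmaps.restrict T _ _) := ⟨hK, hT.mapsToRestrict hmaps⟩
  obtain ⟨x, hx, hfix, -⟩ := hcontr.exists_fixedPoint' Metric.isClosed_closedBall.isComplete
    hmaps hmem (edist_ne_top _ _)
  refine ⟨x, ⟨hx, hfix⟩, fun y ⟨hy, hyfix⟩ => ?_⟩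
  exact congrArg Subtype.val (hcontr.fixedPoint_unique' (x := ⟨y, hy⟩) (y := ⟨x, hx⟩)
    (Subtype.ext hyfix) (Subtype.ext hfix))


/-- Radii polynomial theorem: existence and uniqueness of a fixed point of
`T = I - A ∘ F` in the closed ball `B(X̄, r)`. -/
theorem radii_polynomial_fixed_point
    {X Y : Type*} [NormedAddCommGroup X] [NormedSpace ℝ X] [CompleteSpace X]
    [NormedAddCommGroup Y] [NormedSpace ℝ Y] [CompleteSpace Y]
    (F : X → Y) (DF : X → X →L[ℝ] Y)
    (hF : ContDiff ℝ 1 F) (hDF : ∀ x : X, HasFDerivAt F (DF x) x)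
    (A : Y →L[ℝ] X) (Adag : X →L[ℝ] Y)
    (Xbar : X) (r Y₀ Z₀ Z₁ Z₂ : ℝ) (hr : 0 < r)
    (hY₀ : 0 ≤ Y₀) (hZ₀ : 0 ≤ Z₀) (hZ₁ : 0 ≤ Z₁) (hZ₂ : 0 ≤ Z₂)
    (hY : ‖A (F Xbar)‖ ≤ Y₀)
    (h0 : ‖ContinuousLinearMap.id ℝ X - A.comp Adag‖ ≤ Z₀)
    (h1 : ‖A.comp (DF Xbar - Adag)‖ ≤ Z₁)
    (h2 : ∀ x ∈ Metric.closedBall Xbar r, ‖A.comp (DF x - DF Xbar)‖ ≤ r * Z₂)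
    (hP : Z₂ * r ^ 2 - (1 - (Z₀ + Z₁)) * r + Y₀ < 0) :
    ∃! x : X, x ∈ Metric.closedBall Xbar r ∧ x - A (F x) = x := by
  have hKnn : 0 ≤ Z₀ + Z₁ + r * Z₂ := by positivity
  have hlt : Z₀ + Z₁ + r * Z₂ < 1 := by
    by_contra! h
    nlinarith [mul_le_mul_of_nonneg_right h hr.le]
  have hderiv (x : X) :
      HasFDerivAt (fun x => x - A (F x)) (ContinuousLinearMap.id ℝ X - A.comp (DF x)) x :=
    (hasFDerivAt_id x).sub (A.hasFDerivAt.comp x (hDF x))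
  have hbound : ∀ x ∈ Metric.closedBall Xbar r,
      ‖ContinuousLinearMap.id ℝ X - A.comp (DF x)‖ ≤ Z₀ + Z₁ + r * Z₂ := fun x hx => by
    have hsplit : ContinuousLinearMap.id ℝ X - A.comp (DF x) =
        (ContinuousLinearMap.id ℝ X - A.comp Adag) - A.comp (DF Xbar - Adag)
          - A.comp (DF x - DF Xbar) := by
      simp only [ContinuousLinearMap.comp_sub]
      abel
    rw [hsplit]
    exact norm_sub_le_of_le (norm_sub_le_of_le h0 h1) (h2 x hx)
  have hlip : LipschitzOnWith (NNReal.mk (Z₀ + Z₁ + r * Z₂) hKnn) (fun x => x - A (F x))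
      (Metric.closedBall Xbar r) :=
    (convex_closedBall Xbar r).lipschitzOnWith_of_nnnorm_hasFDerivWithin_le
      (fun x _ => (hderiv x).hasFDerivWithinAt) hbound
  refine existsUnique_fixedPoint_closedBall hr.le (NNReal.coe_lt_coe.1 (by simpa using hlt)) hlip ?_
  rw [dist_eq_norm, sub_sub_cancel_left, norm_neg, NNReal.coe_mk]
  nlinarith
end

section
/- Let (X, ‖·‖_X) and (Y, ‖·‖_Y) be real Banach spaces, F : X → Y a C¹ map with Fréchet derivative DF, and A : Y → X, A† : X → Y bounded linear operators, with A injective. Let X̄ ∈ X, r > 0, and nonnegative constants Y₀, Z₀, Z₁, Z₂ satisfy: ‖A(F(X̄))‖_X ≤ Y₀; the operator norm of I − A∘A† on X is ≤ Z₀; the operator norm of A∘(DF(X̄) − A†) is ≤ Z₁; for every X in the closed ball B(X̄, r), the operator norm of A∘(DF(X) − DF(X̄)) is ≤ r·Z₂; and Z₂·r² − (1 − (Z₀ + Z₁))·r + Y₀ < 0. Then F has a unique zero in the closed ball B(X̄, r). -/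
/-- A map on a Banach space whose derivative is bounded by `K` on a closed ball, and which moves the
center by at most `(1 - K)` times the radius, has a unique fixed point in that ball if `K < 1`. -/
theorem existsUnique_isFixedPt_closedBall {E : Type*} [NormedAddCommGroup E] [NormedSpace ℝ E]
    [CompleteSpace E] {T : E → E} {T' : E → E →L[ℝ] E} {c : E} {r K : ℝ} (hr : 0 ≤ r)
    (hK : 0 ≤ K) (hK1 : K < 1) (hT : ∀ x, HasFDerivAt T (T' x) x)
    (hbound : ∀ x ∈ Metric.closedBall c r, ‖T' x‖ ≤ K) (hc : ‖T c - c‖ ≤ (1 - K) * r) :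
    ∃! x : E, x ∈ Metric.closedBall c r ∧ Function.IsFixedPt T x := by
  have hcr : c ∈ Metric.closedBall c r := Metric.mem_closedBall_self hr
  have hlip : ∀ x ∈ Metric.closedBall c r, ∀ y ∈ Metric.closedBall c r,
      ‖T y - T x‖ ≤ K * ‖y - x‖ := fun x hx y hy =>
    (convex_closedBall c r).norm_image_sub_le_of_norm_hasFDerivWithin_le
      (fun z _ => (hT z).hasFDerivWithinAt) hbound hx hy
  have hmaps : Set.MapsTo T (Metric.closedBall c r) (Metric.closedBall c r) := by
    intro x hx
    have hxr : ‖x - c‖ ≤ r := mem_closedBall_iff_norm.1 hx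
    rw [mem_closedBall_iff_norm]
    calc ‖T x - c‖ ≤ ‖T x - T c‖ + ‖T c - c‖ := norm_sub_le_norm_sub_add_norm_sub _ _ _
      _ ≤ K * r + (1 - K) * r :=
        add_le_add ((hlip c hcr x hx).trans (mul_le_mul_of_nonneg_left hxr hK)) hc
      _ = r := by ring
  have hcontr : ContractingWith ⟨K, hK⟩ (hmaps.restrict T _ _) := by
    refine ⟨hK1, LipschitzWith.of_dist_le_mul fun x y => ?_⟩
    rw [Subtype.dist_eq, Subtype.dist_eq, dist_eq_norm, dist_eq_norm]
    exact hlip y y.2 x x.2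
  obtain ⟨x, hx, hfix, -⟩ := hcontr.exists_fixedPoint' Metric.isClosed_closedBall.isComplete hmaps
    hcr (edist_ne_top _ _)
  refine ⟨x, ⟨hx, hfix⟩, fun y ⟨hy, hyfix⟩ => ?_⟩
  have h := hlip x hx y hy
  rw [hfix.eq, hyfix.eq] at h
  have h0 : ‖y - x‖ = 0 := by nlinarith [norm_nonneg (y - x)]
  exact sub_eq_zero.1 (norm_eq_zero.1 h0)


/-- Radii polynomial theorem: for injective `A`, existence and uniqueness of a zero of `F` in the closed ball `B(X̄, r)`. -/
theorem radii_polynomial_unique_zero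
    {X Y : Type*} [NormedAddCommGroup X] [NormedSpace ℝ X] [CompleteSpace X]
    [NormedAddCommGroup Y] [NormedSpace ℝ Y] [CompleteSpace Y]
    (F : X → Y) (DF : X → X →L[ℝ] Y)
    (hF : ContDiff ℝ 1 F) (hDF : ∀ x : X, HasFDerivAt F (DF x) x)
    (A : Y →L[ℝ] X) (Adag : X →L[ℝ] Y) (hA : Function.Injective A)
    (Xbar : X) (r Y₀ Z₀ Z₁ Z₂ : ℝ) (hr : 0 < r)
    (hY₀ : 0 ≤ Y₀) (hZ₀ : 0 ≤ Z₀) (hZ₁ : 0 ≤ Z₁) (hZ₂ : 0 ≤ Z₂)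
    (hY : ‖A (F Xbar)‖ ≤ Y₀)
    (h0 : ‖ContinuousLinearMap.id ℝ X - A.comp Adag‖ ≤ Z₀)
    (h1 : ‖A.comp (DF Xbar - Adag)‖ ≤ Z₁)
    (h2 : ∀ x ∈ Metric.closedBall Xbar r, ‖A.comp (DF x - DF Xbar)‖ ≤ r * Z₂)
    (hP : Z₂ * r ^ 2 - (1 - (Z₀ + Z₁)) * r + Y₀ < 0) :
    ∃! x : X, x ∈ Metric.closedBall Xbar r ∧ F x = 0 := by
  have hK1 : Z₀ + Z₁ + r * Z₂ < 1 := by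
    by_contra! h
    nlinarith [mul_le_mul_of_nonneg_left h hr.le]
  have hfix : ∀ x, Function.IsFixedPt (fun x => x - A (F x)) x ↔ F x = 0 := fun x => by
    rw [Function.IsFixedPt, sub_eq_self, map_eq_zero_iff A hA]
  simp only [← hfix]
  refine existsUnique_isFixedPt_closedBall (T' := fun x => ContinuousLinearMap.id ℝ X - A.comp (DF x))
    hr.le (by positivity) hK1
    (fun x => (hasFDerivAt_id x).sub (A.hasFDerivAt.comp x (hDF x))) (fun x hx => ?_) ?_
  · have hsplit : ContinuousLinearMap.id ℝ X - A.comp (DF x) =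
        (ContinuousLinearMap.id ℝ X - A.comp Adag) - A.comp (DF Xbar - Adag)
          - A.comp (DF x - DF Xbar) := by
      simp only [ContinuousLinearMap.comp_sub]
      abel
    rw [hsplit]
    exact (norm_sub_le _ _).trans
      (add_le_add ((norm_sub_le _ _).trans (add_le_add h0 h1)) (h2 x hx))
  · rw [sub_sub_cancel_left, norm_neg]
    nlinarith
end

section
/- Let ν > 1, let d₁, d₂ > 0 and d₁₂, r₁, r₂, a₁, a₂, b₁, b₂ ≥ 0, and let v, w, p, s be real sequences in ℓ¹_ν satisfying, for all k ≥ 0: (i) −(πk)² w_k + r₁ (p∗w)_k − a₁ (p∗p∗w∗w)_k − b₁ (p∗v∗w)_k = 0; (ii) d₂ πk s_k + r₂ v_k − a₂ (v∗v)_k − b₂ (p∗v∗w)_k = 0; (iii) −πk p_k + d₁₂ (s ⋆ (p∗p))_k = 0 for all k ≥ 1; (iv) −πk v_k − s_k = 0; and (v) (p_0 + 2·Σ_{k≥1} p_k)·(d₁ + d₁₂·(v_0 + 2·Σ_{k≥1} v_k)) = 1. Define the functions v(x) = v_0 + 2·Σ_{k≥1} v_k cos(kπx) and w(x) = w_0 +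 2·Σ_{k≥1} w_k cos(kπx), and assume v(x) > 0 and w(x) > 0 for all x ∈ [0,1]. Define u(x) = p(x)·w(x) with p(x) = p_0 + 2·Σ_{k≥1} p_k cos(kπx). Then u and v are smooth positive functions on [0,1] that satisfy ((d₁ + d₁₂ v) u)'' + (r₁ − a₁ u − b₁ v) u = 0 and d₂ v'' + (r₂ − b₂ u − a₂ v) v = 0 on (0,1), together with the Neumann boundary conditions u'(0) = u'(1) = 0 and v'(0) = v'(1) = 0. -/
open scoped BigOperators
open Real Set

/-- The convolution product `(u∗v)_k = ∑_{k₁+k₂=k, k₁,k₂∈ℤ} u_{|k₁|} v_{|k₂|}`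
(real coefficients). -/
noncomputable def rconv (u v : ℕ → ℝ) (k : ℕ) : ℝ :=
  ∑' j : ℤ, u j.natAbs * v ((k : ℤ) - j).natAbs

/-- The convolution product `(u⋆v)_k = ∑_{k₁+k₂=k, k₁,k₂∈ℤ} sgn(k₁) u_{|k₁|} v_{|k₂|}`,
with `sgn(0) = 0` (real coefficients). -/
noncomputable def rstarConv (u v : ℕ → ℝ) (k : ℕ) : ℝ :=
  ∑' j : ℤ, (j.sign : ℝ) * u j.natAbs * v ((k : ℤ) - j).natAbs

theorem hasSum_convolution {𝕜 : Type*} [NormedField 𝕜] [CompleteSpace 𝕜] {c d : ℤ → 𝕜}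
    (hc : Summable fun j => ‖c j‖) (hd : Summable fun j => ‖d j‖) :
    HasSum (fun k => ∑' j, c j * d (k - j)) ((∑' j, c j) * ∑' j, d j) := by
  let e : ℤ × ℤ ≃ ℤ × ℤ :=
    { toFun := fun q => (q.2, q.1 - q.2)
      invFun := fun q => (q.1 + q.2, q.1)
      left_inv := fun q => by simp
      right_inv := fun q => by simp }
  have h := summable_mul_of_summable_norm hc hd
  have h' : HasSum (fun q : ℤ × ℤ => c q.2 * d (q.1 - q.2)) ((∑' j, c j) * ∑' j, d j) := by
    rw [tsum_mul_tsum_of_summable_norm hc hd]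
    exact (e.hasSum_iff (f := fun q : ℤ × ℤ => c q.1 * d q.2)).2 h.hasSum
  exact h'.prod_fiberwise fun k => (h'.summable.prod_factor k).hasSum

/-- The even extension of a sequence to the integers. -/
def evenExt (u : ℕ → ℝ) (j : ℤ) : ℝ := u j.natAbs

/-- The odd extension of a sequence to the integers (vanishing at `0`). -/
def oddExt (u : ℕ → ℝ) (j : ℤ) : ℝ := (j.sign : ℝ) * u j.natAbs

theorem evenExt_neg (u : ℕ → ℝ) (j : ℤ) : evenExt u (-j) = evenExt u j := by simp [evenExt]

theorem oddExt_neg (u : ℕ → ℝ) (j : ℤ) : oddExt u (-j) = -oddExt u j := by simp [oddExt]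

theorem abs_oddExt_le (u : ℕ → ℝ) (j : ℤ) : |oddExt u j| ≤ |evenExt u j| := by
  rcases lt_trichotomy j 0 with h | rfl | h
  · simp [oddExt, evenExt, Int.sign_eq_neg_one_of_neg h]
  · simp [oddExt]
  · simp [oddExt, evenExt, Int.sign_eq_one_of_pos h]

theorem evenExt_rconv (u v : ℕ → ℝ) (k : ℤ) :
    evenExt (rconv u v) k = ∑' j, evenExt u j * evenExt v (k - j) := by
  obtain ⟨n, rfl | rfl⟩ := k.eq_nat_or_neg
  · simp [evenExt, rconv]
  · rw [evenExt_neg, ← (Equiv.neg ℤ).tsum_eq]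
    simp only [Equiv.neg_apply, evenExt_neg]
    refine tsum_congr fun j => ?_
    rw [show -(n : ℤ) - -j = -(n - j) by ring, evenExt_neg]
    rfl

theorem oddExt_rstarConv (u v : ℕ → ℝ) (k : ℤ) :
    oddExt (rstarConv u v) k = ∑' j, oddExt u j * evenExt v (k - j) := by
  have hneg : ∀ k : ℤ, ∑' j, oddExt u j * evenExt v (-k - j)
      = -∑' j, oddExt u j * evenExt v (k - j) := fun k => by
    rw [← (Equiv.neg ℤ).tsum_eq, ← tsum_neg]
    refine tsum_congr fun j => ?_
    rw [Equiv.neg_apply, oddExt_neg, show -k - -j = -(k - j) by ring, evenExt_neg, neg_mul]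
  have hnat : ∀ n : ℕ, oddExt (rstarConv u v) n = ∑' j, oddExt u j * evenExt v (n - j) := by
    rintro (_ | n)
    · have h := hneg 0
      rw [neg_zero] at h
      simp only [oddExt, Nat.cast_zero, Int.sign_zero, Int.cast_zero, zero_mul] at h ⊢
      linarith
    · rw [oddExt, Int.sign_eq_one_of_pos (by positivity)]
      simp only [Int.natAbs_natCast, Int.cast_one, one_mul]
      rfl
  obtain ⟨n, rfl | rfl⟩ := k.eq_nat_or_neg
  · exact hnat n
  · rw [oddExt_neg, hneg, hnat]

theorem summable_evenExt_rconv {u v : ℕ → ℝ} (hu : Summable (evenExt u))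
    (hv : Summable (evenExt v)) : Summable (evenExt (rconv u v)) :=
  (hasSum_convolution hu.norm hv.norm).summable.congr fun k => (evenExt_rconv u v k).symm

theorem summable_oddExt {u : ℕ → ℝ} (hu : Summable (evenExt u)) : Summable (oddExt u) :=
  Summable.of_norm_bounded hu.norm (abs_oddExt_le u)

/-- The function with Fourier coefficients `c` on the interval `[-1, 1]`. -/
noncomputable def fourierSum (c : ℤ → ℝ) (x : ℝ) : ℂ :=
  ∑' j : ℤ, (c j : ℂ) * Complex.exp (Complex.I * (π * j * x))

theorem norm_mode (c : ℝ) (j : ℤ) (x : ℝ) :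
    ‖(c : ℂ) * Complex.exp (Complex.I * (π * j * x))‖ = |c| := by
  rw [norm_mul, Complex.norm_real, Real.norm_eq_abs,
    show Complex.I * (π * j * x) = ((π * j * x : ℝ) : ℂ) * Complex.I by push_cast; ring,
    Complex.norm_exp_ofReal_mul_I, mul_one]

theorem hasSum_fourierSum {c : ℤ → ℝ} (hc : Summable c) (x : ℝ) :
    HasSum (fun j : ℤ => (c j : ℂ) * Complex.exp (Complex.I * (π * j * x))) (fourierSum c x) :=
  (Summable.of_norm (by simpa only [norm_mode] using hc.abs)).hasSum

theorem fourierSum_convolution {c d : ℤ → ℝ} (hc : Summable c) (hd : Summable d) (x : ℝ) :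
    fourierSum (fun k => ∑' j, c j * d (k - j)) x = fourierSum c x * fourierSum d x := by
  have h := hasSum_convolution
    (c := fun j : ℤ => (c j : ℂ) * Complex.exp (Complex.I * (π * j * x)))
    (d := fun j : ℤ => (d j : ℂ) * Complex.exp (Complex.I * (π * j * x)))
    (by simpa only [norm_mode] using hc.abs) (by simpa only [norm_mode] using hd.abs)
  rw [fourierSum, fourierSum, fourierSum, ← h.tsum_eq]
  refine tsum_congr fun k => ?_
  rw [Complex.ofReal_tsum, ← tsum_mul_right]
  refine tsum_congr fun j => ?_
  rw [show Complex.I * (π * k * x) = Complex.I * (π * j * x)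
    + Complex.I * (π * (k - j : ℤ) * x) by push_cast; ring, Complex.exp_add]
  push_cast
  ring

theorem fourierSum_rconv {u v : ℕ → ℝ} (hu : Summable (evenExt u)) (hv : Summable (evenExt v))
    (x : ℝ) : fourierSum (evenExt (rconv u v)) x
      = fourierSum (evenExt u) x * fourierSum (evenExt v) x := by
  rw [← fourierSum_convolution hu hv, funext (evenExt_rconv u v)]

theorem fourierSum_rstarConv {u v : ℕ → ℝ} (hu : Summable (evenExt u))
    (hv : Summable (evenExt v)) (x : ℝ) : fourierSum (oddExt (rstarConv u v)) x
      = fourierSum (oddExt u) x * fourierSum (evenExt v) x := by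
  rw [← fourierSum_convolution (summable_oddExt hu) hv, funext (oddExt_rstarConv u v)]

theorem fourierSum_const_mul (a : ℝ) (c : ℤ → ℝ) (x : ℝ) :
    fourierSum (fun j => a * c j) x = a * fourierSum c x := by
  rw [fourierSum, fourierSum, ← tsum_mul_left]
  exact tsum_congr fun j => by push_cast; ring

theorem tsum_int_eq_zero_add_tsum_nat {f : ℤ → ℂ} (hf : Summable f) :
    ∑' j, f j = f 0 + ∑' n : ℕ, (f (n + 1) + f (-(n + 1))) := by
  have h₁ : Summable fun n : ℕ => f (n + 1) :=
    hf.comp_injective (i := fun n : ℕ => (n : ℤ) + 1) fun a b hab => by simpa using hab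
  have h₂ : Summable fun n : ℕ => f (-(n + 1)) :=
    hf.comp_injective (i := fun n : ℕ => -((n : ℤ) + 1)) fun a b hab => by simpa using hab
  rw [tsum_of_add_one_of_neg_add_one h₁ h₂, h₁.tsum_add h₂]
  ring

theorem fourierSum_evenExt {u : ℕ → ℝ} (hu : Summable (evenExt u)) (x : ℝ) :
    fourierSum (evenExt u) x
      = ((u 0 + 2 * ∑' k : ℕ, u (k + 1) * Real.cos (((k : ℝ) + 1) * π * x) : ℝ) : ℂ) := by
  rw [fourierSum, tsum_int_eq_zero_add_tsum_nat (hasSum_fourierSum hu x).summable]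
  push_cast
  rw [← tsum_mul_left]
  congr 1
  · simp [evenExt]
  · refine tsum_congr fun n => ?_
    rw [evenExt_neg, evenExt, Complex.cos, show ((n : ℤ) + 1).natAbs = n + 1 by omega]
    rw [show Complex.I * (π * (n + 1) * x) = (n + 1) * π * x * Complex.I by ring,
      show Complex.I * (π * -(n + 1) * x) = -((n + 1) * π * x) * Complex.I by ring]
    ring

/-- Two-sided sequences all of whose polynomial multiples are absolutely summable. -/
def RapidDecay (c : ℤ → ℝ) : Prop :=
  ∀ m : ℕ, Summable fun j : ℤ => (j : ℝ) ^ m * c j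

theorem RapidDecay.summable {c : ℤ → ℝ} (hc : RapidDecay c) : Summable c := by
  simpa using hc 0

theorem RapidDecay.deriv {c : ℤ → ℝ} (hc : RapidDecay c) :
    RapidDecay fun j => π * j * c j := fun m =>
  ((hc (m + 1)).mul_left π).congr fun j => by ring

theorem rapidDecay_evenExt {ν : ℝ} (hν : 1 < ν) {u : ℕ → ℝ}
    (hu : Summable fun k : ℕ => |u k| * ν ^ k) : RapidDecay (evenExt u) := fun m => by
  obtain ⟨C, hC⟩ := (tendsto_pow_const_div_const_pow_of_one_lt m hν).bddAbove_range
  have hs : Summable fun k : ℕ => (k : ℝ) ^ m * |u k| := by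
    refine Summable.of_nonneg_of_le (fun k => by positivity) (fun k => ?_) (hu.mul_left C)
    have h : (k : ℝ) ^ m / ν ^ k ≤ C := hC ⟨k, rfl⟩
    rw [div_le_iff₀ (by positivity)] at h
    nlinarith [mul_le_mul_of_nonneg_right h (abs_nonneg (u k))]
  have hn : ∀ k : ℤ, ‖(k : ℝ) ^ m * evenExt u k‖ = (k.natAbs : ℝ) ^ m * |u k.natAbs| :=
    fun k => by simp [evenExt, Nat.cast_natAbs]
  refine Summable.of_norm ?_
  simp only [hn]
  exact Summable.of_nat_of_neg (by simpa using hs) (by simpa using hs)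

theorem hasDerivAt_fourierSum {c : ℤ → ℝ} (hc : RapidDecay c) (x : ℝ) :
    HasDerivAt (fourierSum c) (Complex.I * fourierSum (fun j => π * j * c j) x) x := by
  have hg : ∀ (j : ℤ) (y : ℝ),
      HasDerivAt (fun y : ℝ => (c j : ℂ) * Complex.exp (Complex.I * (π * j * y)))
        (Complex.I * (((π * j * c j : ℝ) : ℂ) * Complex.exp (Complex.I * (π * j * y)))) y := by
    intro j y
    have h := (((hasDerivAt_id y).ofReal_comp.const_mul (π * j : ℂ)).const_mul
      Complex.I).cexp.const_mul (c j : ℂ)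
    refine h.congr_deriv ?_
    simp only [id, Complex.ofReal_one, Complex.ofReal_mul, Complex.ofReal_intCast]
    ring
  have hg' : ∀ (j : ℤ) (y : ℝ),
      ‖Complex.I * (((π * j * c j : ℝ) : ℂ) * Complex.exp (Complex.I * (π * j * y)))‖
        ≤ |π * j * c j| := fun j y => by
    rw [norm_mul, norm_mode, Complex.norm_I, one_mul]
  have h := hasDerivAt_tsum hc.deriv.summable.abs hg hg'
    (hasSum_fourierSum hc.summable 0).summable x
  rw [tsum_mul_left] at h
  exact h

theorem RapidDecay.contDiff_fourierSum {c : ℤ → ℝ} (hc : RapidDecay c) :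
    ContDiff ℝ (⊤ : ℕ∞) (fourierSum c) := by
  refine contDiff_infty.2 fun n => ?_
  induction n generalizing c with
  | zero =>
    exact contDiff_zero.2 (continuous_iff_continuousAt.2 fun x =>
      (hasDerivAt_fourierSum hc x).continuousAt)
  | succ n ih =>
    push_cast
    refine contDiff_succ_iff_deriv.2
      ⟨fun x => (hasDerivAt_fourierSum hc x).differentiableAt, by simp, ?_⟩
    rw [funext fun x => (hasDerivAt_fourierSum hc x).deriv]
    exact contDiff_const.mul (ih hc.deriv)

theorem deriv_eq_zero_of_symm {f : ℝ → ℝ} (a : ℝ) (hf : ∀ x, f (2 * a - x) = f x) :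
    deriv f a = 0 := by
  have h : deriv (fun x => f (2 * a - x)) a = -deriv f (2 * a - a) := deriv_comp_const_sub ..
  rw [funext hf, show 2 * a - a = a by ring] at h
  linarith

theorem eq_zero_of_hasDerivAt_mul {f h : ℝ → ℝ} (hh : Continuous h)
    (hf : ∀ x, HasDerivAt f (h x * f x) x) (h0 : f 0 = 0) (x : ℝ) : f x = 0 := by
  have hd : ∀ y, HasDerivAt (fun y => f y * Real.exp (-∫ t in (0 : ℝ)..y, h t)) 0 y := fun y => by
    exact ((hf y).mul (hh.integral_hasStrictDerivAt 0 y).hasDerivAt.neg.exp).congr_deriv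
      (by ring)
  have hc := is_const_of_deriv_eq_zero (fun y => (hd y).differentiableAt)
    (fun y => (hd y).deriv) x 0
  simpa [h0] using hc

theorem fourierSum_linearCombination {a b c d : ℤ → ℝ} (α β γ δ : ℝ) (ha : Summable a)
    (hb : Summable b) (hc : Summable c) (hd : Summable d)
    (h : ∀ j, α * a j + β * b j + γ * c j + δ * d j = 0) (x : ℝ) :
    α * fourierSum a x + β * fourierSum b x + γ * fourierSum c x + δ * fourierSum d x = 0 := by
  refine (((((hasSum_fourierSum ha x).mul_left (α : ℂ)).add
    ((hasSum_fourierSum hb x).mul_left (β : ℂ))).add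
    ((hasSum_fourierSum hc x).mul_left (γ : ℂ))).add
    ((hasSum_fourierSum hd x).mul_left (δ : ℂ))).unique ?_
  convert hasSum_zero using 2 with j
  have hj := congrArg (Complex.ofReal) (h j)
  push_cast at hj
  linear_combination Complex.exp (Complex.I * (π * j * x)) * hj

theorem contDiff_of_ofReal_eq_fourierSum {c : ℤ → ℝ} (hc : RapidDecay c) {f : ℝ → ℝ}
    (hf : ∀ x, (f x : ℂ) = fourierSum c x) : ContDiff ℝ (⊤ : ℕ∞) f := by
  have h : f = fun x => Complex.reCLM (fourierSum c x) := funext fun x => by simp [← hf]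
  rw [h]
  exact Complex.reCLM.contDiff.comp hc.contDiff_fourierSum

theorem ofReal_deriv_eq_fourierSum {c : ℤ → ℝ} (hc : RapidDecay c) {f : ℝ → ℝ}
    (hf : ∀ x, (f x : ℂ) = fourierSum c x) (x : ℝ) :
    ((deriv f x : ℝ) : ℂ) = Complex.I * fourierSum (fun j => π * j * c j) x := by
  have hd : HasDerivAt f (deriv f x) x :=
    ((contDiff_of_ofReal_eq_fourierSum hc hf).differentiable (by simp) x).hasDerivAt
  have h := hd.ofReal_comp
  rw [funext hf] at h
  exact h.unique (hasDerivAt_fourierSum hc x)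

theorem ofReal_deriv_deriv_eq_fourierSum {c : ℤ → ℝ} (hc : RapidDecay c) {f : ℝ → ℝ}
    (hf : ∀ x, (f x : ℂ) = fourierSum c x) (x : ℝ) :
    ((deriv (deriv f) x : ℝ) : ℂ) = -fourierSum (fun j => π * j * (π * j * c j)) x := by
  have hs := contDiff_of_ofReal_eq_fourierSum hc hf
  have hd : HasDerivAt (deriv f) (deriv (deriv f) x) x :=
    ((contDiff_infty_iff_deriv.1 hs).2.differentiable (by simp) x).hasDerivAt
  have h := hd.ofReal_comp
  rw [funext (ofReal_deriv_eq_fourierSum hc hf)] at h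
  rw [h.unique ((hasDerivAt_fourierSum hc.deriv x).const_mul Complex.I), ← mul_assoc,
    Complex.I_mul_I, neg_one_mul]

theorem cosineSeries_symm (u : ℕ → ℝ) (m : ℕ) (x : ℝ) :
    u 0 + 2 * ∑' k : ℕ, u (k + 1) * Real.cos (((k : ℝ) + 1) * π * (2 * m - x))
      = u 0 + 2 * ∑' k : ℕ, u (k + 1) * Real.cos (((k : ℝ) + 1) * π * x) := by
  congr 3
  funext k
  rw [show ((k : ℝ) + 1) * π * (2 * m - x)
    = ((k + 1) * m : ℕ) * (2 * π) - (k + 1) * π * x by push_cast; ring,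
    Real.cos_nat_mul_two_pi_sub]

theorem mul_evenExt (u : ℕ → ℝ) (j : ℤ) :
    π * j * evenExt u j = oddExt (fun k => π * k * u k) j := by
  have h : (j : ℝ) = j.sign * j.natAbs := by
    rw [← Int.cast_natCast, ← Int.cast_mul, Int.sign_mul_natAbs]
  simp only [evenExt, oddExt]
  nth_rewrite 1 [h]
  ring

theorem sq_mul_evenExt (u : ℕ → ℝ) (j : ℤ) :
    π * j * (π * j * evenExt u j) = (π * j.natAbs) ^ 2 * u j.natAbs := by
  have h : (j.natAbs : ℝ) ^ 2 = (j : ℝ) ^ 2 := by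
    rw [Nat.cast_natAbs, Int.cast_abs, sq_abs]
  rw [mul_pow, h, evenExt]
  ring

/-- If `(v, w, p, s) ∈ (ℓ¹_ν(ℝ))⁴` solves the algebraic system obtained by Fourier-projecting
the steady-state triangular cross-diffusion system, and if the associated functions `v(x)` and
`w(x)` are positive on `[0,1]`, then `u = p·w` and `v` are smooth positive functions solving
`((d₁+d₁₂v)u)'' + (r₁-a₁u-b₁v)u = 0`, `d₂v'' + (r₂-b₂u-a₂v)v = 0` on `(0,1)` with homogeneous
Neumann boundary conditions. -/
theorem steady_state_from_algebraic_system (ν : ℝ) (hν : 1 < ν)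
    (d₁ d₂ d₁₂ r₁ r₂ a₁ a₂ b₁ b₂ : ℝ)
    (hd₁ : 0 < d₁) (hd₂ : 0 < d₂) (hd₁₂ : 0 ≤ d₁₂) (hr₁ : 0 ≤ r₁) (hr₂ : 0 ≤ r₂)
    (ha₁ : 0 ≤ a₁) (ha₂ : 0 ≤ a₂) (hb₁ : 0 ≤ b₁) (hb₂ : 0 ≤ b₂)
    (v w p s : ℕ → ℝ)
    (hv : Summable fun k : ℕ => |v k| * ν ^ k)
    (hw : Summable fun k : ℕ => |w k| * ν ^ k)
    (hp : Summable fun k : ℕ => |p k| * ν ^ k)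
    (hs : Summable fun k : ℕ => |s k| * ν ^ k)
    (heqw : ∀ k : ℕ, -(π * k) ^ 2 * w k + r₁ * rconv p w k
      - a₁ * rconv (rconv (rconv p p) w) w k - b₁ * rconv (rconv p v) w k = 0)
    (heqs : ∀ k : ℕ, d₂ * (π * k) * s k + r₂ * v k - a₂ * rconv v v k
      - b₂ * rconv (rconv p v) w k = 0)
    (heqp : ∀ k : ℕ, 1 ≤ k → -(π * k) * p k + d₁₂ * rstarConv s (rconv p p) k = 0)
    (heqv : ∀ k : ℕ, -(π * k) * v k - s k = 0)
    (heq0 : (p 0 + 2 * ∑' k : ℕ, p (k + 1)) *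
      (d₁ + d₁₂ * (v 0 + 2 * ∑' k : ℕ, v (k + 1))) = 1)
    (V W P U : ℝ → ℝ)
    (hV : V = fun x : ℝ => v 0 + 2 * ∑' k : ℕ, v (k + 1) * Real.cos (((k : ℝ) + 1) * π * x))
    (hW : W = fun x : ℝ => w 0 + 2 * ∑' k : ℕ, w (k + 1) * Real.cos (((k : ℝ) + 1) * π * x))
    (hP : P = fun x : ℝ => p 0 + 2 * ∑' k : ℕ, p (k + 1) * Real.cos (((k : ℝ) + 1) * π * x))
    (hU : U = fun x : ℝ => P x * W x)
    (hVpos : ∀ x ∈ Icc (0 : ℝ) 1, 0 < V x)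
    (hWpos : ∀ x ∈ Icc (0 : ℝ) 1, 0 < W x) :
    ContDiff ℝ (⊤ : ℕ∞) U ∧ ContDiff ℝ (⊤ : ℕ∞) V ∧
    (∀ x ∈ Icc (0 : ℝ) 1, 0 < U x) ∧ (∀ x ∈ Icc (0 : ℝ) 1, 0 < V x) ∧
    (∀ x ∈ Ioo (0 : ℝ) 1,
      deriv (deriv (fun y : ℝ => (d₁ + d₁₂ * V y) * U y)) x
        + (r₁ - a₁ * U x - b₁ * V x) * U x = 0) ∧
    (∀ x ∈ Ioo (0 : ℝ) 1,
      d₂ * deriv (deriv V) x + (r₂ - b₂ * U x - a₂ * V x) * V x = 0) ∧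
    deriv U 0 = 0 ∧ deriv U 1 = 0 ∧ deriv V 0 = 0 ∧ deriv V 1 = 0 := by
  have hv' := rapidDecay_evenExt hν hv
  have hw' := rapidDecay_evenExt hν hw
  have hp' := rapidDecay_evenExt hν hp
  have hs' := (rapidDecay_evenExt hν hs).summable
  have hVF : ∀ x, (V x : ℂ) = fourierSum (evenExt v) x := fun x => by
    rw [fourierSum_evenExt hv'.summable, hV]
  have hWF : ∀ x, (W x : ℂ) = fourierSum (evenExt w) x := fun x => by
    rw [fourierSum_evenExt hw'.summable, hW]
  have hPF : ∀ x, (P x : ℂ) = fourierSum (evenExt p) x := fun x => by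
    rw [fourierSum_evenExt hp'.summable, hP]
  have hVs := contDiff_of_ofReal_eq_fourierSum hv' hVF
  have hWs := contDiff_of_ofReal_eq_fourierSum hw' hWF
  have hPs := contDiff_of_ofReal_eq_fourierSum hp' hPF
  have hUs : ContDiff ℝ (⊤ : ℕ∞) U := hU ▸ hPs.mul hWs
  have hpp := summable_evenExt_rconv hp'.summable hp'.summable
  have hppw := summable_evenExt_rconv hpp hw'.summable
  have hpv := summable_evenExt_rconv hp'.summable hv'.summable
  have hpw := summable_evenExt_rconv hp'.summable hw'.summable
  have hpvw := summable_evenExt_rconv hpv hw'.summable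
  have hpvwF : ∀ x, fourierSum (evenExt (rconv (rconv p v) w)) x = P x * V x * W x := fun x => by
    rw [fourierSum_rconv hpv hw'.summable, fourierSum_rconv hp'.summable hv'.summable,
      hPF, hVF, hWF]
  have hWode : ∀ x, deriv (deriv W) x + r₁ * (P x * W x) - a₁ * (P x * P x * W x * W x)
      - b₁ * (P x * V x * W x) = 0 := fun x => by
    have h := fourierSum_linearCombination (-1) r₁ (-a₁) (-b₁) hw'.deriv.deriv.summable hpw
      (summable_evenExt_rconv hppw hw'.summable) hpvw
      (fun j => by
        rw [sq_mul_evenExt]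
        simp only [evenExt]
        linear_combination heqw j.natAbs) x
    rw [hpvwF, fourierSum_rconv hp'.summable hw'.summable, fourierSum_rconv hppw hw'.summable,
      fourierSum_rconv hpp hw'.summable, fourierSum_rconv hp'.summable hp'.summable,
      ← hPF, ← hWF, ← neg_eq_iff_eq_neg.2 (ofReal_deriv_deriv_eq_fourierSum hw' hWF x)] at h
    apply Complex.ofReal_injective
    push_cast at h ⊢
    linear_combination h
  have hVode : ∀ x, d₂ * deriv (deriv V) x + r₂ * V x - a₂ * (V x * V x)
      - b₂ * (P x * V x * W x) = 0 := fun x => by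
    have h := fourierSum_linearCombination (-d₂) r₂ (-a₂) (-b₂) hv'.deriv.deriv.summable
      hv'.summable (summable_evenExt_rconv hv'.summable hv'.summable) hpvw
      (fun j => by
        rw [sq_mul_evenExt]
        simp only [evenExt]
        linear_combination heqs j.natAbs + d₂ * (π * j.natAbs) * heqv j.natAbs) x
    rw [hpvwF, fourierSum_rconv hv'.summable hv'.summable, ← hVF,
      ← neg_eq_iff_eq_neg.2 (ofReal_deriv_deriv_eq_fourierSum hv' hVF x)] at h
    apply Complex.ofReal_injective
    push_cast at h ⊢
    linear_combination h
  have hPode : ∀ x, deriv P x = -d₁₂ * deriv V x * P x ^ 2 := fun x => by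
    have hpc : (fun j : ℤ => π * j * evenExt p j)
        = fun j => d₁₂ * oddExt (rstarConv s (rconv p p)) j := funext fun j => by
      rw [mul_evenExt]
      rcases Nat.eq_zero_or_pos j.natAbs with h | h
      · simp [oddExt, Int.natAbs_eq_zero.1 h]
      · simp only [oddExt]
        linear_combination -(j.sign : ℝ) * heqp _ h
    have hvc : (fun j : ℤ => π * j * evenExt v j) = fun j => (-1) * oddExt s j :=
      funext fun j => by
        rw [mul_evenExt]
        simp only [oddExt]
        linear_combination -(j.sign : ℝ) * heqv j.natAbs
    have h₁ := ofReal_deriv_eq_fourierSum hp' hPF x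
    have h₂ := ofReal_deriv_eq_fourierSum hv' hVF x
    rw [hpc, fourierSum_const_mul, fourierSum_rstarConv hs' hpp,
      fourierSum_rconv hp'.summable hp'.summable, ← hPF] at h₁
    rw [hvc, fourierSum_const_mul] at h₂
    apply Complex.ofReal_injective
    push_cast at h₂ ⊢
    linear_combination h₁ + d₁₂ * (P x : ℂ) ^ 2 * h₂
  have hPD : ∀ x, P x * (d₁ + d₁₂ * V x) = 1 := fun x => by
    have h := eq_zero_of_hasDerivAt_mul (f := fun x => 1 - P x * (d₁ + d₁₂ * V x))
      (h := fun x => -P x * (d₁₂ * deriv V x))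
      (hPs.continuous.neg.mul (continuous_const.mul (hVs.continuous_deriv (by simp))))
      (fun y => by
        have hP' : HasDerivAt P (deriv P y) y :=
          (hPs.differentiable (by simp) y).hasDerivAt
        have hV' : HasDerivAt V (deriv V y) y :=
          (hVs.differentiable (by simp) y).hasDerivAt
        refine ((hP'.mul ((hV'.const_mul d₁₂).const_add d₁)).const_sub 1).congr_deriv ?_
        rw [hPode]
        ring)
      (by simpa [hP, hV, sub_eq_zero] using heq0.symm) x
    linarith
  have hD : ∀ x ∈ Icc (0 : ℝ) 1, 0 < d₁ + d₁₂ * V x := fun x hx => by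
    have := mul_nonneg hd₁₂ (hVpos x hx).le
    linarith
  have hDU : (fun y : ℝ => (d₁ + d₁₂ * V y) * U y) = W := funext fun y => by
    rw [hU]
    linear_combination W y * hPD y
  have hVsymm : ∀ (m : ℕ) (x : ℝ), V (2 * m - x) = V x := fun m x => by
    rw [hV]; exact cosineSeries_symm v m x
  have hUsymm : ∀ (m : ℕ) (x : ℝ), U (2 * m - x) = U x := fun m x => by
    rw [hU, hP, hW]
    exact congrArg₂ (· * ·) (cosineSeries_symm p m x) (cosineSeries_symm w m x)
  refine ⟨hUs, hVs, fun x hx => ?_, hVpos, fun x _ => ?_, fun x _ => ?_,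
    by simpa using deriv_eq_zero_of_symm _ (hUsymm 0),
    by simpa using deriv_eq_zero_of_symm _ (hUsymm 1),
    by simpa using deriv_eq_zero_of_symm _ (hVsymm 0),
    by simpa using deriv_eq_zero_of_symm _ (hVsymm 1)⟩
  · have hPpos : 0 < P x := pos_of_mul_pos_left (by rw [hPD]; exact one_pos) (hD x hx).le
    rw [hU]
    exact mul_pos hPpos (hWpos x hx)
  · rw [hDU, hU]
    linear_combination hWode x
  · rw [hU]
    linear_combination hVode x
end
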